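/- For all b ≥ 1 and s > 1/2 there exists a constant C_s > 0 such that for all 0 < δ < 1 and all f, g ∈ G^{δ,s,b}(ℝ), the product satisfies ‖fg‖_{δ,s,b} ≤ C_s ‖f‖_{δ,s,b} ‖g‖_{δ,s,b}; i.e., G^{δ,s,b}(ℝ) is a Banach algebra up to a constant. -/

import Mathlib

open MeasureTheory
open scoped FourierTransform

/-- The Gevrey–Sobolev norm `‖f‖_{δ,s,b}` of a function `f : ℝ → ℂ`,
defined via its Fourier transform `𝓕 f`:
`‖f‖²_{δ,s,b} = ∫ (1+|ξ|²)^s e^{2δ|ξ|^{1/b}} |𝓕 f (ξ)|² dξ`. -/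
noncomputable def GnormF (δ s b : ℝ) (f : ℝ → ℂ) : ℝ :=
  (∫ ξ : ℝ, (1 + ξ ^ 2) ^ s * Real.exp (2 * δ * |ξ| ^ (1 / b)) * ‖𝓕 f ξ‖ ^ 2) ^ (1 / 2 : ℝ)

lemma gs_dual (u v : ℝ → ℂ) (hu : Integrable u) (hv : Integrable v) :
    ∫ x, 𝓕 u x * v x = ∫ x, u x * 𝓕 v x := by
  simpa using! (VectorFourier.integral_fourierIntegral_smul_eq_flip (L := innerₗ ℝ)
      Real.continuous_fourierChar continuous_inner hu hv)

lemma gs_cont (u : ℝ → ℂ) (hu : Integrable u) : Continuous (𝓕 u) :=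
  VectorFourier.fourierIntegral_continuous Real.continuous_fourierChar
    (L := innerₗ ℝ) continuous_inner hu

lemma gs_inv (g : ℝ → ℂ) (hg : Integrable g) (hG : Integrable (𝓕 g)) :
    ∀ᵐ x, g x = 𝓕 (fun y => 𝓕 g (-y)) x := by
  have hG' : Integrable (fun y => 𝓕 g (-y)) := hG.comp_neg
  apply ae_eq_of_integral_contDiff_smul_eq hg.locallyIntegrable
    (gs_cont _ hG').locallyIntegrable
  intro p hp hpc
  have h1 : HasCompactSupport (fun x => (p x : ℂ)) := hpc.comp_left (g := fun t : ℝ => (t : ℂ)) (by simp)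
  let ψ : SchwartzMap ℝ ℂ := h1.toSchwartzMap (Complex.ofRealCLM.contDiff.comp hp)
  have hψ : ∀ x, ψ x = (p x : ℂ) := fun x => rfl
  let φ : SchwartzMap ℝ ℂ := 𝓕⁻ ψ
  have e : (ψ : ℝ → ℂ) = 𝓕 (φ : ℝ → ℂ) := by
    rw [← SchwartzMap.fourier_coe, FourierTransform.fourier_fourierInv_eq]
  have e2 : ∀ x, φ x = 𝓕 (ψ : ℝ → ℂ) (-x) := by
    intro x
    rw [← Real.fourierInv_eq_fourier_neg, ← SchwartzMap.fourierInv_coe]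
  simp only [Complex.real_smul, ← hψ]
  rw [← gs_dual _ _ ψ.integrable hG']
  calc ∫ x, ψ x * g x = ∫ x, 𝓕 (φ : ℝ → ℂ) x * g x := by rw [← e]
    _ = ∫ x, φ x * 𝓕 g x := gs_dual _ _ φ.integrable hg
    _ = ∫ x, φ (-x) * 𝓕 g (-x) := (integral_neg_eq_self (fun x => φ x * 𝓕 g x) volume).symm
    _ = _ := by simp only [e2, neg_neg]

lemma gs_conv (f g : ℝ → ℂ) (hf : Integrable f) (hg : Integrable g) (hG : Integrable (𝓕 g))
    (ξ : ℝ) : 𝓕 (fun x => f x * g x) ξ = ∫ η, 𝓕 f (ξ - η) * 𝓕 g η := by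
  have hG' : Integrable (fun y => 𝓕 g (-y)) := hG.comp_neg
  have hm : Integrable (fun x : ℝ => (Real.fourierChar (-(x * ξ))) • f x) := by
    have := (Real.fourierIntegral_convergent_iff (μ := volume) (f := f) ξ).2 hf
    simpa [mul_comm] using this
  have hF : ∀ η, 𝓕 (fun x : ℝ => (Real.fourierChar (-(x * ξ))) • f x) η = 𝓕 f (ξ + η) := by
    intro η
    rw [Real.fourier_real_eq, Real.fourier_real_eq]
    congr 1; ext x
    rw [smul_smul, ← AddChar.map_add_eq_mul]
    congr 2; ring
  rw [Real.fourier_real_eq]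
  calc ∫ x, (Real.fourierChar (-(x * ξ))) • (f x * g x)
      = ∫ x, ((Real.fourierChar (-(x * ξ))) • f x) * 𝓕 (fun y => 𝓕 g (-y)) x := by
        apply integral_congr_ae
        filter_upwards [gs_inv g hg hG] with x hx
        rw [← hx, smul_mul_assoc]
    _ = ∫ η, 𝓕 f (ξ + η) * 𝓕 g (-η) := by
        rw [← gs_dual _ _ hm hG']; simp only [hF]
    _ = _ := by
        rw [← integral_neg_eq_self (fun η => 𝓕 f (ξ + η) * 𝓕 g (-η)) volume]
        simp only [neg_neg, ← sub_eq_add_neg]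

noncomputable def gsW (δ s b ξ : ℝ) : ℝ := (1 + ξ ^ 2) ^ s * Real.exp (2 * δ * |ξ| ^ (1 / b))
noncomputable def gsJ (s ξ : ℝ) : ℝ := (1 + ξ ^ 2) ^ (-s)

lemma gsJ_pos (s ξ : ℝ) : 0 < gsJ s ξ := by unfold gsJ; positivity
lemma gsW_pos (δ s b ξ : ℝ) : 0 < gsW δ s b ξ := by unfold gsW; positivity

lemma gsJ_int (s : ℝ) (hs : 1 / 2 < s) : Integrable (gsJ s) := by
  have := integrable_rpow_neg_one_add_norm_sq (E := ℝ) (μ := volume) (r := 2 * s)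
    (by simp; linarith)
  refine this.congr (ae_of_all _ fun x => ?_)
  simp only [gsJ, Real.norm_eq_abs, sq_abs]
  congr 1; ring

lemma gsJ_cont (s : ℝ) : Continuous (gsJ s) := by
  unfold gsJ
  exact Continuous.rpow_const (by fun_prop) (fun x => Or.inl (by positivity))

lemma gsW_cont (δ s b : ℝ) (hb : 1 ≤ b) : Continuous (gsW δ s b) := by
  unfold gsW
  refine Continuous.mul ?_ ?_
  · exact Continuous.rpow_const (by fun_prop) (fun x => Or.inl (by positivity))
  · have : Continuous fun x : ℝ => |x| ^ (1 / b) :=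
      Continuous.rpow_const (by fun_prop) (fun x => Or.inr (by positivity))
    fun_prop

lemma gsJW (δ s b ξ : ℝ) (hδ : 0 < δ) : 1 ≤ gsJ s ξ * gsW δ s b ξ := by
  unfold gsJ gsW
  rw [← mul_assoc, ← Real.rpow_add (by positivity)]
  simp only [neg_add_cancel, Real.rpow_zero, one_mul]
  apply Real.one_le_exp; positivity

lemma gs_pt (δ s b : ℝ) (hb : 1 ≤ b) (hs : 1 / 2 < s) (hδ : 0 < δ) (ξ η : ℝ) :
    gsW δ s b ξ ≤ 4 ^ s * (gsJ s (ξ - η) + gsJ s η) * (gsW δ s b (ξ - η) * gsW δ s b η) := by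
  set ζ := ξ - η with hζ
  have hξ : ξ = ζ + η := by rw [hζ]; ring
  have he : Real.exp (2 * δ * |ξ| ^ (1 / b)) ≤
      Real.exp (2 * δ * |ζ| ^ (1 / b)) * Real.exp (2 * δ * |η| ^ (1 / b)) := by
    rw [← Real.exp_add, ← mul_add]
    apply Real.exp_le_exp.2
    gcongr
    calc |ξ| ^ (1 / b) ≤ (|ζ| + |η|) ^ (1 / b) := by
          rw [hξ]; gcongr; exact abs_add_le _ _
      _ ≤ _ := Real.rpow_add_le_add_rpow (abs_nonneg _) (abs_nonneg _) (by positivity)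
          (by rw [div_le_one (by linarith)]; exact hb)
  have hp : (1 + ξ ^ 2) ^ s ≤ 4 ^ s * ((1 + ζ ^ 2) ^ s + (1 + η ^ 2) ^ s) := by
    rcases le_total (ζ ^ 2) (η ^ 2) with h | h
    · calc (1 + ξ ^ 2) ^ s ≤ (4 * (1 + η ^ 2)) ^ s := by
            apply Real.rpow_le_rpow (by positivity) _ (by linarith)
            rw [hξ]; nlinarith [sq_nonneg (ζ - η)]
        _ = 4 ^ s * (1 + η ^ 2) ^ s := Real.mul_rpow (by norm_num) (by positivity)
        _ ≤ _ := by gcongr; have : 0 ≤ (1 + ζ ^ 2) ^ s := by positivity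
                    linarith
    · calc (1 + ξ ^ 2) ^ s ≤ (4 * (1 + ζ ^ 2)) ^ s := by
            apply Real.rpow_le_rpow (by positivity) _ (by linarith)
            rw [hξ]; nlinarith [sq_nonneg (ζ - η)]
        _ = 4 ^ s * (1 + ζ ^ 2) ^ s := Real.mul_rpow (by norm_num) (by positivity)
        _ ≤ _ := by gcongr; have : 0 ≤ (1 + η ^ 2) ^ s := by positivity
                    linarith
  have h1 : (1 + ζ ^ 2) ^ (-s) * (1 + ζ ^ 2) ^ s = 1 := by
    rw [← Real.rpow_add (by positivity)]; simp
  have h2 : (1 + η ^ 2) ^ (-s) * (1 + η ^ 2) ^ s = 1 := by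
    rw [← Real.rpow_add (by positivity)]; simp
  unfold gsW gsJ
  calc _ ≤ (4 ^ s * ((1 + ζ ^ 2) ^ s + (1 + η ^ 2) ^ s)) *
      (Real.exp (2 * δ * |ζ| ^ (1 / b)) * Real.exp (2 * δ * |η| ^ (1 / b))) := by gcongr
    _ = _ := by
      linear_combination (-(4 ^ s * Real.exp (2 * δ * |ζ| ^ (1 / b)) * Real.exp (2 * δ * |η| ^ (1 / b)) * (1 + η ^ 2) ^ s)) * h1 + (-(4 ^ s * Real.exp (2 * δ * |ζ| ^ (1 / b)) * Real.exp (2 * δ * |η| ^ (1 / b)) * (1 + ζ ^ 2) ^ s)) * h2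

lemma gs_Fint (δ s b : ℝ) (hs : 1 / 2 < s) (hδ : 0 < δ) (g : ℝ → ℂ) (hg : Integrable g)
    (h : Integrable (fun ξ => gsW δ s b ξ * ‖𝓕 g ξ‖ ^ 2)) : Integrable (𝓕 g) := by
  refine ((gsJ_int s hs).add h).mono' (gs_cont g hg).aestronglyMeasurable (ae_of_all _ fun x => ?_)
  simp only [Pi.add_apply]
  have h1 := gsJW δ s b x hδ
  have h2 := gsJ_pos s x
  have h3 := gsW_pos δ s b x
  have h4 := norm_nonneg (𝓕 g x)
  set j := gsJ s x
  set w := gsW δ s b x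
  set n := ‖𝓕 g x‖
  have : n ^ 2 ≤ (j + w * n ^ 2) ^ 2 := by
    nlinarith [sq_nonneg (j - w * n ^ 2), mul_le_mul_of_nonneg_right h1 (sq_nonneg n), sq_nonneg n]
  exact le_of_sq_le_sq this (by positivity)

lemma gs_CS (a c : ℝ → ENNReal) (ha : AEMeasurable a) (hc : AEMeasurable c) :
    (∫⁻ x, a x * c x) ^ 2 ≤ (∫⁻ x, a x ^ 2) * ∫⁻ x, c x ^ 2 := by
  have := ENNReal.lintegral_mul_le_Lp_mul_Lq volume Real.HolderConjugate.two_two ha hc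
  have h2 := pow_le_pow_left' this 2
  refine h2.trans (le_of_eq ?_)
  rw [mul_pow, ← ENNReal.rpow_natCast, ← ENNReal.rpow_natCast, ← ENNReal.rpow_mul,
    ← ENNReal.rpow_mul]
  simp

lemma gs_main (δ s b : ℝ) (hb : 1 ≤ b) (hs : 1 / 2 < s) (hδ : 0 < δ) (f g : ℝ → ℂ)
    (hf : Integrable f) (hg : Integrable g) (hfg : Integrable (fun x => f x * g x))
    (hA : Integrable (fun ξ => gsW δ s b ξ * ‖𝓕 f ξ‖ ^ 2))
    (hB : Integrable (fun ξ => gsW δ s b ξ * ‖𝓕 g ξ‖ ^ 2)) :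
    ∫ ξ, gsW δ s b ξ * ‖𝓕 (fun x => f x * g x) ξ‖ ^ 2 ≤
      (4 ^ s * (2 * ∫ x, gsJ s x)) * (∫ ξ, gsW δ s b ξ * ‖𝓕 f ξ‖ ^ 2) *
        ∫ ξ, gsW δ s b ξ * ‖𝓕 g ξ‖ ^ 2 := by
  have hWc := gsW_cont δ s b hb
  have hJc := gsJ_cont s
  have hFc := gs_cont f hf
  have hGc := gs_cont g hg
  have hFGc := gs_cont _ hfg
  have hJ := gsJ_int s hs
  have hJ0 : 0 ≤ ∫ x, gsJ s x := integral_nonneg fun x => (gsJ_pos s x).le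
  set A : ℝ → ℝ := fun ξ => gsW δ s b ξ * ‖𝓕 f ξ‖ ^ 2 with hAdef
  set B : ℝ → ℝ := fun ξ => gsW δ s b ξ * ‖𝓕 g ξ‖ ^ 2 with hBdef
  have hA0 : ∀ x, 0 ≤ A x := fun x => mul_nonneg (gsW_pos _ _ _ _).le (by positivity)
  have hB0 : ∀ x, 0 ≤ B x := fun x => mul_nonneg (gsW_pos _ _ _ _).le (by positivity)
  have hAc : Continuous A := by fun_prop
  have hBc : Continuous B := by fun_prop
  have hGint := gs_Fint δ s b hs hδ g hg hB
  have hIA : 0 ≤ ∫ ξ, A ξ := integral_nonneg hA0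
  have hIB : 0 ≤ ∫ ξ, B ξ := integral_nonneg hB0
  have key : ∀ ξ, ENNReal.ofReal (gsW δ s b ξ * ‖𝓕 (fun x => f x * g x) ξ‖ ^ 2) ≤
      ENNReal.ofReal (4 ^ s * (2 * ∫ x, gsJ s x)) *
        ∫⁻ η, ENNReal.ofReal (A (ξ - η)) * ENNReal.ofReal (B η) := by
    intro ξ
    let a : ℝ → ENNReal := fun η => ENNReal.ofReal (√(4 ^ s * (gsJ s (ξ - η) + gsJ s η)))
    let c : ℝ → ENNReal := fun η => ENNReal.ofReal (√(A (ξ - η) * B η))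
    have ham : Measurable a := by
      unfold a; apply Measurable.ennreal_ofReal; apply Continuous.measurable; fun_prop
    have hcm : Measurable c := by
      unfold c; apply Measurable.ennreal_ofReal; apply Continuous.measurable; fun_prop
    have h1 : ENNReal.ofReal (√(gsW δ s b ξ)) * ‖𝓕 (fun x => f x * g x) ξ‖ₑ ≤ ∫⁻ η, a η * c η := by
      rw [gs_conv f g hf hg hGint ξ]
      calc _ ≤ ENNReal.ofReal (√(gsW δ s b ξ)) * ∫⁻ η, ‖𝓕 f (ξ - η) * 𝓕 g η‖ₑ := by
            gcongr; exact enorm_integral_le_lintegral_enorm _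
        _ = ∫⁻ η, ENNReal.ofReal (√(gsW δ s b ξ)) * ‖𝓕 f (ξ - η) * 𝓕 g η‖ₑ := by
            rw [lintegral_const_mul']; exact ENNReal.ofReal_ne_top
        _ ≤ _ := by
            apply lintegral_mono; intro η
            simp only [a, c]
            rw [← ofReal_norm, ← ENNReal.ofReal_mul (by positivity),
              ← ENNReal.ofReal_mul (by positivity)]
            apply ENNReal.ofReal_le_ofReal
            have hJ1 := gsJ_pos s (ξ - η)
            have hJ2 := gsJ_pos s η
            rw [← Real.sqrt_mul (by positivity), norm_mul]
            apply Real.le_sqrt_of_sq_le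
            rw [mul_pow, Real.sq_sqrt (gsW_pos _ _ _ _).le]
            have := mul_le_mul_of_nonneg_right (gs_pt δ s b hb hs hδ ξ η)
              (sq_nonneg (‖𝓕 f (ξ - η)‖ * ‖𝓕 g η‖))
            refine this.trans (le_of_eq ?_)
            simp only [hAdef, hBdef]; ring
    have h2 := (pow_le_pow_left' h1 2).trans (gs_CS a c ham.aemeasurable hcm.aemeasurable)
    have h3 : ∫⁻ x, a x ^ 2 = ENNReal.ofReal (4 ^ s * (2 * ∫ x, gsJ s x)) := by
      have hint : Integrable (fun η => 4 ^ s * (gsJ s (ξ - η) + gsJ s η)) :=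
        ((hJ.comp_sub_left ξ).add hJ).const_mul _
      have e1 : ∫ η, 4 ^ s * (gsJ s (ξ - η) + gsJ s η) = 4 ^ s * (2 * ∫ x, gsJ s x) := by
        rw [integral_const_mul, integral_add (hJ.comp_sub_left ξ) hJ,
          integral_sub_left_eq_self (gsJ s) volume ξ]; ring
      rw [← e1, ofReal_integral_eq_lintegral_ofReal hint]
      · congr 1; ext η
        have hJ1 := gsJ_pos s (ξ - η)
        have hJ2 := gsJ_pos s η
        simp only [a]
        rw [← ENNReal.ofReal_pow (by positivity), Real.sq_sqrt (by positivity)]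
      · exact ae_of_all _ fun η => by
          have hJ1 := gsJ_pos s (ξ - η)
          have hJ2 := gsJ_pos s η
          simp only [Pi.zero_apply]
          positivity
    have h4 : ∫⁻ x, c x ^ 2 = ∫⁻ η, ENNReal.ofReal (A (ξ - η)) * ENNReal.ofReal (B η) := by
      congr 1; ext η
      simp only [c]
      rw [← ENNReal.ofReal_pow (by positivity),
        Real.sq_sqrt (mul_nonneg (hA0 _) (hB0 _)), ENNReal.ofReal_mul (hA0 _)]
    rw [h3, h4] at h2
    refine le_trans (le_of_eq ?_) h2
    rw [← ofReal_norm, mul_pow, ← ENNReal.ofReal_pow (by positivity),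
      ← ENNReal.ofReal_pow (by positivity), Real.sq_sqrt (gsW_pos _ _ _ _).le,
      ENNReal.ofReal_mul (gsW_pos _ _ _ _).le]
  have tot : ∫⁻ ξ, ENNReal.ofReal (gsW δ s b ξ * ‖𝓕 (fun x => f x * g x) ξ‖ ^ 2) ≤
      ENNReal.ofReal ((4 ^ s * (2 * ∫ x, gsJ s x)) * (∫ ξ, A ξ) * ∫ ξ, B ξ) := by
    refine (lintegral_mono key).trans (le_of_eq ?_)
    rw [lintegral_const_mul' _ _ ENNReal.ofReal_ne_top, lintegral_lintegral_swap]
    · have : ∀ η, ∫⁻ ξ, ENNReal.ofReal (A (ξ - η)) * ENNReal.ofReal (B η) =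
          ENNReal.ofReal (∫ ξ, A ξ) * ENNReal.ofReal (B η) := by
        intro η
        rw [lintegral_mul_const' _ _ ENNReal.ofReal_ne_top,
          lintegral_sub_right_eq_self (fun x => ENNReal.ofReal (A x)) η,
          ofReal_integral_eq_lintegral_ofReal hA (ae_of_all _ hA0)]
      simp only [this]
      rw [lintegral_const_mul' _ _ ENNReal.ofReal_ne_top,
        ← ofReal_integral_eq_lintegral_ofReal hB (ae_of_all _ hB0), mul_assoc,
        ENNReal.ofReal_mul (p := 4 ^ s * (2 * ∫ x, gsJ s x)) (by positivity),
        ENNReal.ofReal_mul hIA]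
    · apply Measurable.aemeasurable
      unfold Function.uncurry
      fun_prop
  rw [integral_eq_lintegral_of_nonneg_ae]
  · exact ENNReal.toReal_le_of_le_ofReal (by positivity) tot
  · exact ae_of_all _ fun x => mul_nonneg (gsW_pos _ _ _ _).le (by positivity)
  · apply Continuous.aestronglyMeasurable; fun_prop

/-- Algebra property: for `b ≥ 1` and `s > 1/2` there is a constant `C_s > 0`
such that for all `0 < δ < 1` and all `f, g ∈ G^{δ,s,b}(ℝ)`,
`‖fg‖_{δ,s,b} ≤ C_s ‖f‖_{δ,s,b} ‖g‖_{δ,s,b}`. -/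
theorem stmt_8 :
    ∀ b : ℝ, 1 ≤ b → ∀ s : ℝ, 1 / 2 < s → ∃ C : ℝ, 0 < C ∧
      ∀ δ : ℝ, 0 < δ → δ < 1 → ∀ f g : ℝ → ℂ,
        Integrable f → Integrable g → Integrable (fun x => f x * g x) →
        Integrable (fun ξ : ℝ =>
          (1 + ξ ^ 2) ^ s * Real.exp (2 * δ * |ξ| ^ (1 / b)) * ‖𝓕 f ξ‖ ^ 2) →
        Integrable (fun ξ : ℝ =>
          (1 + ξ ^ 2) ^ s * Real.exp (2 * δ * |ξ| ^ (1 / b)) * ‖𝓕 g ξ‖ ^ 2) →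
        GnormF δ s b (fun x => f x * g x) ≤ C * GnormF δ s b f * GnormF δ s b g := by
  intro b hb s hs
  have hJ0 : 0 ≤ ∫ x, gsJ s x := integral_nonneg fun x => (gsJ_pos s x).le
  have hM : 0 ≤ (4 : ℝ) ^ s * (2 * ∫ x, gsJ s x) := by positivity
  refine ⟨(4 ^ s * (2 * ∫ x, gsJ s x) + 1) ^ (1 / 2 : ℝ), by positivity, ?_⟩
  intro δ hδ _ f g hf hg hfg hA hB
  have key := gs_main δ s b hb hs hδ f g hf hg hfg hA hB
  have hA0 : 0 ≤ ∫ ξ, gsW δ s b ξ * ‖𝓕 f ξ‖ ^ 2 :=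
    integral_nonneg fun x => mul_nonneg (gsW_pos _ _ _ _).le (by positivity)
  have hB0 : 0 ≤ ∫ ξ, gsW δ s b ξ * ‖𝓕 g ξ‖ ^ 2 :=
    integral_nonneg fun x => mul_nonneg (gsW_pos _ _ _ _).le (by positivity)
  have hX0 : 0 ≤ ∫ ξ, gsW δ s b ξ * ‖𝓕 (fun x => f x * g x) ξ‖ ^ 2 :=
    integral_nonneg fun x => mul_nonneg (gsW_pos _ _ _ _).le (by positivity)
  change (∫ ξ, gsW δ s b ξ * ‖𝓕 (fun x => f x * g x) ξ‖ ^ 2) ^ (1 / 2 : ℝ) ≤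
    (4 ^ s * (2 * ∫ x, gsJ s x) + 1) ^ (1 / 2 : ℝ) *
      (∫ ξ, gsW δ s b ξ * ‖𝓕 f ξ‖ ^ 2) ^ (1 / 2 : ℝ) *
      (∫ ξ, gsW δ s b ξ * ‖𝓕 g ξ‖ ^ 2) ^ (1 / 2 : ℝ)
  rw [← Real.mul_rpow (by positivity) hA0, ← Real.mul_rpow (by positivity) hB0]
  apply Real.rpow_le_rpow hX0 _ (by norm_num)
  refine key.trans ?_
  gcongr
  linarith
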